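/- Let F be a field and let γ₂ ∈ Sp_8(F) be the matrix, in 2×2 block form, with block (rows 1–2, columns 7–8) equal to −I_2, block (rows 3–6, columns 3–6) equal to I_4, block (rows 7–8, columns 1–2) equal to I_2, and all other entries 0. Then { p ∈ P_{2,8}(F) : γ₂·p·γ₂^{−1} ∈ P_8(F) } = { diag(g₀, h₀, J_2 ᵗg₀^{−1} J_2) · v(0,y,0) : g₀ ∈ GL_2(F), h₀ ∈ P_4(F), y ∈ Mat_2(F) }. -/

import Mathlib

open Matrix

namespace GS

noncomputable section

/-- `Jmat F n` : the `n × n` matrix over `F` with ones on the antidiagonal, zeros elsewhere. -/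
def Jmat (F : Type*) [Field F] (n : ℕ) : Matrix (Fin n) (Fin n) F :=
  Matrix.of fun i j => if (i : ℕ) + (j : ℕ) = n - 1 then (1 : F) else 0

/-- The symplectic form matrix `((0, J_n), (-J_n, 0))` in `n × n` block form. -/
def OmegaMat (F : Type*) [Field F] (n : ℕ) : Matrix (Fin (n + n)) (Fin (n + n)) F :=
  Matrix.reindex finSumFinEquiv finSumFinEquiv
    (Matrix.fromBlocks 0 (Jmat F n) (-(Jmat F n)) 0)

/-- `Sp_{2n}(F) = { g : ᵗg Ω g = Ω }`. -/
def SpSet (F : Type*) [Field F] (n : ℕ) : Set (Matrix (Fin (n + n)) (Fin (n + n)) F) :=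
  {g | gᵀ * OmegaMat F n * g = OmegaMat F n}

/-- `Sp_4(F)`. -/
def Sp4 (F : Type*) [Field F] : Set (Matrix (Fin 4) (Fin 4) F) := SpSet F 2

/-- `Sp_8(F)`. -/
def Sp8 (F : Type*) [Field F] : Set (Matrix (Fin 8) (Fin 8) F) := SpSet F 4

/-- `Sp_16(F)`. -/
def Sp16 (F : Type*) [Field F] : Set (Matrix (Fin 16) (Fin 16) F) := SpSet F 8

/-- `Mat_2^0(F) = { A : ᵗA J₂ = J₂ A }`. -/
def Mat20 (F : Type*) [Field F] : Set (Matrix (Fin 2) (Fin 2) F) :=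
  {A | Aᵀ * Jmat F 2 = Jmat F 2 * A}

/-- `y* = J₂ ᵗy J₂`. -/
def starJ (F : Type*) [Field F] (y : Matrix (Fin 2) (Fin 2) F) : Matrix (Fin 2) (Fin 2) F :=
  Jmat F 2 * yᵀ * Jmat F 2

/-- Assemble an `8 × 8` matrix from sixteen `2 × 2` blocks. -/
def blk8 (F : Type*) [Field F] (B : Fin 4 → Fin 4 → Matrix (Fin 2) (Fin 2) F) :
    Matrix (Fin 8) (Fin 8) F :=
  Matrix.of fun i j =>
    B ⟨(i : ℕ) / 2, by have := i.isLt; omega⟩ ⟨(j : ℕ) / 2, by have := j.isLt; omega⟩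
      ⟨(i : ℕ) % 2, by omega⟩ ⟨(j : ℕ) % 2, by omega⟩

/-- The matrix `v(x, y, z)`: identity except block `(1,2) = x`, `(1,3) = y`,
`(1,4) = z`, `(2,4) = y* = J₂ ᵗy J₂`, `(3,4) = x* = -J₂ ᵗx J₂`. -/
def vMat (F : Type*) [Field F] (x y z : Matrix (Fin 2) (Fin 2) F) :
    Matrix (Fin 8) (Fin 8) F :=
  blk8 F fun bi bj =>
    if bi = bj then (1 : Matrix (Fin 2) (Fin 2) F)
    else if bi = 0 ∧ bj = 1 then x
    else if bi = 0 ∧ bj = 2 then y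
    else if bi = 0 ∧ bj = 3 then z
    else if bi = 1 ∧ bj = 3 then starJ F y
    else if bi = 2 ∧ bj = 3 then -(starJ F x)
    else 0

/-- `N_{2,8}(F)`. -/
def N28 (F : Type*) [Field F] : Set (Matrix (Fin 8) (Fin 8) F) :=
  {M | ∃ x y z : Matrix (Fin 2) (Fin 2) F,
    z - x * starJ F y ∈ Mat20 F ∧ M = vMat F x y z}

/-- The center subgroup `N_{2,8}^c(F) = { v(0,0,z) : z ∈ Mat_2^0(F) }`. -/
def N28c (F : Type*) [Field F] : Set (Matrix (Fin 8) (Fin 8) F) :=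
  {M | ∃ z ∈ Mat20 F, M = vMat F 0 0 z}

/-- The underlying set of the Heisenberg group `H_9(F)`. -/
abbrev H9 (F : Type*) [Field F] :=
  Matrix (Fin 2) (Fin 2) F × Matrix (Fin 2) (Fin 2) F × F

/-- The Heisenberg multiplication on `H_9(F)` attached to `T`. -/
def H9mul (F : Type*) [Field F] (T : Matrix (Fin 2) (Fin 2) F) (a b : H9 F) : H9 F :=
  (a.1 + b.1, a.2.1 + b.2.1,
    a.2.2 + b.2.2 +
      (T * (a.1 * (Jmat F 2 * b.2.1ᵀ * Jmat F 2) -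
            a.2.1 * (Jmat F 2 * b.1ᵀ * Jmat F 2))).trace)

/-- The `8 × 8` block diagonal matrix `diag(m, h, m')` with blocks of sizes `2, 4, 2`. -/
def diag242 (F : Type*) [Field F] (m : Matrix (Fin 2) (Fin 2) F)
    (h : Matrix (Fin 4) (Fin 4) F) (m' : Matrix (Fin 2) (Fin 2) F) :
    Matrix (Fin 8) (Fin 8) F :=
  Matrix.of fun i j =>
    if hi : (i : ℕ) < 2 then
      if hj : (j : ℕ) < 2 then m ⟨(i : ℕ), hi⟩ ⟨(j : ℕ), hj⟩ else 0
    else if hi2 : (i : ℕ) < 6 then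
      if hj2 : 2 ≤ (j : ℕ) ∧ (j : ℕ) < 6 then
        h ⟨(i : ℕ) - 2, by omega⟩ ⟨(j : ℕ) - 2, by omega⟩
      else 0
    else
      if hj3 : 6 ≤ (j : ℕ) then
        m' ⟨(i : ℕ) - 6, by have := i.isLt; omega⟩ ⟨(j : ℕ) - 6, by have := j.isLt; omega⟩
      else 0

/-- The segment (`{1,2}`, `{3,4,5,6}` or `{7,8}`) of an index in `Fin 8`. -/
def seg8 (i : Fin 8) : ℕ := if (i : ℕ) < 2 then 0 else if (i : ℕ) < 6 then 1 else 2

/-- `w = ((0, I₂), (I₂, 0))`. -/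
def wMat (F : Type*) [Field F] : Matrix (Fin 4) (Fin 4) F :=
  Matrix.reindex finSumFinEquiv finSumFinEquiv
    (Matrix.fromBlocks (0 : Matrix (Fin 2) (Fin 2) F) (1 : Matrix (Fin 2) (Fin 2) F)
      (1 : Matrix (Fin 2) (Fin 2) F) (0 : Matrix (Fin 2) (Fin 2) F))

/-- The embedding `t : Sp₄ × Sp₄ → Mat₁₆`, with respect to the partition of `{1,…,16}`
into `I₁ = {1,…,4}`, `I₂ = {5,6}`, `I₃ = {7,…,10}`, `I₄ = {11,12}`, `I₅ = {13,…,16}`: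
block `(I₁,I₁) = g₁`, `(I₃,I₃) = g₂`, `(I₅,I₅) = J₄ ᵗg₁⁻¹ J₄`, `(I₂,I₂) = g_{1,1}`,
`(I₂,I₄) = g_{1,2}`, `(I₄,I₂) = g_{1,3}`, `(I₄,I₄) = g_{1,4}`, all other blocks zero. -/
def tEmb (F : Type*) [Field F] (g₁ g₂ : Matrix (Fin 4) (Fin 4) F) :
    Matrix (Fin 16) (Fin 16) F :=
  Matrix.of fun i j =>
    if hi1 : (i : ℕ) < 4 then
      if hj1 : (j : ℕ) < 4 then g₁ ⟨(i : ℕ), hi1⟩ ⟨(j : ℕ), hj1⟩ else 0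
    else if hi2 : (i : ℕ) < 6 then
      if hj2 : 4 ≤ (j : ℕ) ∧ (j : ℕ) < 6 then
        g₁ ⟨(i : ℕ) - 4, by omega⟩ ⟨(j : ℕ) - 4, by omega⟩
      else if hj4 : 10 ≤ (j : ℕ) ∧ (j : ℕ) < 12 then
        g₁ ⟨(i : ℕ) - 4, by omega⟩ ⟨(j : ℕ) - 10 + 2, by omega⟩
      else 0
    else if hi3 : (i : ℕ) < 10 then
      if hj3 : 6 ≤ (j : ℕ) ∧ (j : ℕ) < 10 then
        g₂ ⟨(i : ℕ) - 6, by omega⟩ ⟨(j : ℕ) - 6, by omega⟩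
      else 0
    else if hi4 : (i : ℕ) < 12 then
      if hj2 : 4 ≤ (j : ℕ) ∧ (j : ℕ) < 6 then
        g₁ ⟨(i : ℕ) - 10 + 2, by omega⟩ ⟨(j : ℕ) - 4, by omega⟩
      else if hj4 : 10 ≤ (j : ℕ) ∧ (j : ℕ) < 12 then
        g₁ ⟨(i : ℕ) - 10 + 2, by omega⟩ ⟨(j : ℕ) - 10 + 2, by omega⟩
      else 0
    else
      if hj5 : 12 ≤ (j : ℕ) then
        (Jmat F 4 * (g₁⁻¹)ᵀ * Jmat F 4) ⟨(i : ℕ) - 12, by have := i.isLt; omega⟩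
          ⟨(j : ℕ) - 12, by have := j.isLt; omega⟩
      else 0

/-- `γ₁`: entry `(1,8) = -1`, entries `(k,k) = 1` for `2 ≤ k ≤ 7`, entry `(8,1) = 1`
(1-indexed), all other entries `0`. -/
def gamma1 (F : Type*) [Field F] : Matrix (Fin 8) (Fin 8) F :=
  Matrix.of fun i j =>
    if (i : ℕ) = 0 ∧ (j : ℕ) = 7 then -1
    else if (i : ℕ) = 7 ∧ (j : ℕ) = 0 then 1
    else if i = j ∧ 1 ≤ (i : ℕ) ∧ (i : ℕ) ≤ 6 then 1
    else 0

/-- `γ₂`: block (rows 1–2, columns 7–8) `= -I₂`, block (rows 3–6, columns 3–6) `= I₄`,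
block (rows 7–8, columns 1–2) `= I₂` (1-indexed), all other entries `0`. -/
def gamma2 (F : Type*) [Field F] : Matrix (Fin 8) (Fin 8) F :=
  Matrix.of fun i j =>
    if (i : ℕ) < 2 ∧ (j : ℕ) = (i : ℕ) + 6 then -1
    else if 2 ≤ (i : ℕ) ∧ (i : ℕ) < 6 ∧ i = j then 1
    else if 6 ≤ (i : ℕ) ∧ (j : ℕ) + 6 = (i : ℕ) then 1
    else 0

/-- The Siegel parabolic `P_8(F)` of `Sp_8(F)`: lower-left `4 × 4` block zero. -/
def P8 (F : Type*) [Field F] : Set (Matrix (Fin 8) (Fin 8) F) :=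
  {g | g ∈ Sp8 F ∧ ∀ i j : Fin 8, 4 ≤ (i : ℕ) → (j : ℕ) < 4 → g i j = 0}

/-- The Siegel parabolic `P_4(F)` of `Sp_4(F)`: lower-left `2 × 2` block zero. -/
def P4 (F : Type*) [Field F] : Set (Matrix (Fin 4) (Fin 4) F) :=
  {h | h ∈ Sp4 F ∧ ∀ i j : Fin 4, 2 ≤ (i : ℕ) → (j : ℕ) < 2 → h i j = 0}

/-- The span of the first two standard basis vectors `e₁, e₂` of `F^8`. -/
def E2 (F : Type*) [Field F] : Submodule F (Fin 8 → F) :=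
  Submodule.span F {Pi.single (0 : Fin 8) (1 : F), Pi.single (1 : Fin 8) (1 : F)}

/-- `P_{2,8}(F)`: elements of `Sp_8(F)` mapping the span of `e₁, e₂` onto itself. -/
def P28 (F : Type*) [Field F] : Set (Matrix (Fin 8) (Fin 8) F) :=
  {g | g ∈ Sp8 F ∧ Submodule.map g.mulVecLin (E2 F) = E2 F}

/-- The double coset `P_8(F) · γ · P_{2,8}(F)`. -/
def dcoset (F : Type*) [Field F] (γ : Matrix (Fin 8) (Fin 8) F) :
    Set (Matrix (Fin 8) (Fin 8) F) :=
  {g | ∃ p ∈ P8 F, ∃ q ∈ P28 F, g = p * γ * q}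

/-- The orbit of `ξ` under the right multiplication action of `GL₂(F)` on `Mat₂(F)`. -/
def rOrbit (F : Type*) [Field F] (ξ : Matrix (Fin 2) (Fin 2) F) :
    Set (Matrix (Fin 2) (Fin 2) F) :=
  {A | ∃ g, IsUnit g ∧ A = ξ * g}


section BlockMatrices

variable {F : Type*} [Field F]

/-- Assemble a `4 × 4` matrix from four `2 × 2` blocks. -/
def blk4 (B : Matrix (Fin 2) (Fin 2) (Matrix (Fin 2) (Fin 2) F)) :
    Matrix (Fin 4) (Fin 4) F :=
  Matrix.of fun i j =>
    B ⟨(i : ℕ) / 2, by have := i.isLt; omega⟩ ⟨(j : ℕ) / 2, by have := j.isLt; omega⟩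
      ⟨(i : ℕ) % 2, by omega⟩ ⟨(j : ℕ) % 2, by omega⟩

theorem blk8_apply (B : Matrix (Fin 4) (Fin 4) (Matrix (Fin 2) (Fin 2) F)) (i j : Fin 4)
    (k l : Fin 2) : blk8 F B (finProdFinEquiv (i, k)) (finProdFinEquiv (j, l)) = B i j k l := by
  fin_cases i <;> fin_cases k <;> fin_cases j <;> fin_cases l <;> rfl

theorem blk4_apply (B : Matrix (Fin 2) (Fin 2) (Matrix (Fin 2) (Fin 2) F)) (i j k l : Fin 2) :
    blk4 B (finProdFinEquiv (i, k)) (finProdFinEquiv (j, l)) = B i j k l := by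
  fin_cases i <;> fin_cases k <;> fin_cases j <;> fin_cases l <;> rfl

theorem blk8_injective : Function.Injective
    (fun B : Matrix (Fin 4) (Fin 4) (Matrix (Fin 2) (Fin 2) F) => blk8 F B) := by
  intro A B h
  ext i j k l
  rw [← blk8_apply A, ← blk8_apply B]
  exact congrFun (congrFun h _) _

theorem blk8_inj {A B : Matrix (Fin 4) (Fin 4) (Matrix (Fin 2) (Fin 2) F)} :
    blk8 F A = blk8 F B ↔ A = B := blk8_injective.eq_iff

theorem blk4_injective : Function.Injective
    (blk4 : Matrix (Fin 2) (Fin 2) (Matrix (Fin 2) (Fin 2) F) → _) := by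
  intro A B h
  ext i j k l
  rw [← blk4_apply A, ← blk4_apply B, h]

theorem exists_blk8 (M : Matrix (Fin 8) (Fin 8) F) :
    ∃ B : Matrix (Fin 4) (Fin 4) (Matrix (Fin 2) (Fin 2) F), M = blk8 F B := by
  refine ⟨.of fun i j => .of fun k l => M (finProdFinEquiv (i, k)) (finProdFinEquiv (j, l)), ?_⟩
  ext i j
  obtain ⟨⟨i, k⟩, rfl⟩ := (finProdFinEquiv (m := 4) (n := 2)).surjective i
  obtain ⟨⟨j, l⟩, rfl⟩ := (finProdFinEquiv (m := 4) (n := 2)).surjective j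
  rw [blk8_apply]
  rfl

theorem exists_blk4 (M : Matrix (Fin 4) (Fin 4) F) :
    ∃ B : Matrix (Fin 2) (Fin 2) (Matrix (Fin 2) (Fin 2) F), M = blk4 B := by
  refine ⟨.of fun i j => .of fun k l => M (finProdFinEquiv (i, k)) (finProdFinEquiv (j, l)), ?_⟩
  ext i j
  obtain ⟨⟨i, k⟩, rfl⟩ := (finProdFinEquiv (m := 2) (n := 2)).surjective i
  obtain ⟨⟨j, l⟩, rfl⟩ := (finProdFinEquiv (m := 2) (n := 2)).surjective j
  rw [blk4_apply]
  rfl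

theorem blk8_mul (A B : Matrix (Fin 4) (Fin 4) (Matrix (Fin 2) (Fin 2) F)) :
    blk8 F A * blk8 F B = blk8 F (A * B) := by
  ext i j
  simp only [Matrix.mul_apply, blk8, Matrix.of_apply, Fin.sum_univ_eight, Fin.sum_univ_four,
    Matrix.add_apply, Fin.sum_univ_two]
  simp only [add_assoc]
  rfl

theorem blk4_mul (A B : Matrix (Fin 2) (Fin 2) (Matrix (Fin 2) (Fin 2) F)) :
    blk4 A * blk4 B = blk4 (A * B) := by
  ext i j
  simp only [Matrix.mul_apply, blk4, Matrix.of_apply, Fin.sum_univ_four,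
    Matrix.add_apply, Fin.sum_univ_two]
  simp only [add_assoc]
  rfl

theorem blk8_transpose (A : Matrix (Fin 4) (Fin 4) (Matrix (Fin 2) (Fin 2) F)) :
    (blk8 F A)ᵀ = blk8 F (Aᵀ.map Matrix.transpose) := rfl

theorem blk4_transpose (A : Matrix (Fin 2) (Fin 2) (Matrix (Fin 2) (Fin 2) F)) :
    (blk4 A)ᵀ = blk4 (Aᵀ.map Matrix.transpose) := rfl

theorem blk8_one : blk8 F (1 : Matrix (Fin 4) (Fin 4) (Matrix (Fin 2) (Fin 2) F)) = 1 := by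
  ext i j
  fin_cases i <;> fin_cases j <;> rfl

theorem omegaMat_four : OmegaMat F 4 =
    blk8 F !![0, 0, 0, Jmat F 2; 0, 0, Jmat F 2, 0; 0, -Jmat F 2, 0, 0; -Jmat F 2, 0, 0, 0] := by
  ext i j
  fin_cases i <;> fin_cases j <;> first | rfl | exact neg_zero (G := F)

theorem omegaMat_two : OmegaMat F 2 = blk4 !![0, Jmat F 2; -Jmat F 2, 0] := by
  ext i j
  fin_cases i <;> fin_cases j <;> simp [OmegaMat, blk4, Jmat, finSumFinEquiv, Fin.addCases]

theorem gamma2_eq_blk8 :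
    gamma2 F = blk8 F !![0, 0, 0, -1; 0, 1, 0, 0; 0, 0, 1, 0; 1, 0, 0, 0] := by
  ext i j
  fin_cases i <;> fin_cases j <;> first | rfl | exact (neg_zero (G := F)).symm

theorem diag242_eq_blk8 (m m' : Matrix (Fin 2) (Fin 2) F)
    (h : Matrix (Fin 2) (Fin 2) (Matrix (Fin 2) (Fin 2) F)) :
    diag242 F m (blk4 h) m' =
      blk8 F !![m, 0, 0, 0; 0, h 0 0, h 0 1, 0; 0, h 1 0, h 1 1, 0; 0, 0, 0, m'] := by
  ext i j
  fin_cases i <;> fin_cases j <;> rfl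

theorem vMat_eq_blk8 (y : Matrix (Fin 2) (Fin 2) F) :
    vMat F 0 y 0 =
      blk8 F !![1, 0, y, 0; 0, 1, 0, starJ F y; 0, 0, 1, 0; 0, 0, 0, 1] := by
  have h : starJ F (0 : Matrix (Fin 2) (Fin 2) F) = 0 := by simp [starJ]
  rw [vMat, h]
  congr 1
  ext i j : 2
  fin_cases i <;> fin_cases j <;> simp

theorem Jmat_two_mul_self : Jmat F 2 * Jmat F 2 = 1 := by
  ext i j
  fin_cases i <;> fin_cases j <;> simp [Jmat, Matrix.mul_apply]

theorem Jmat_two_transpose : (Jmat F 2)ᵀ = Jmat F 2 := by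
  ext i j
  fin_cases i <;> fin_cases j <;> simp [Jmat]

theorem gamma2_inv :
    (gamma2 F)⁻¹ = blk8 F !![0, 0, 0, 1; 0, 1, 0, 0; 0, 0, 1, 0; -1, 0, 0, 0] := by
  refine Matrix.inv_eq_right_inv ?_
  rw [gamma2_eq_blk8, blk8_mul, ← blk8_one]
  congr 1
  ext i j : 2
  fin_cases i <;> fin_cases j <;> simp [Matrix.mul_apply, Fin.sum_univ_four]

theorem conj_gamma2 (B : Matrix (Fin 4) (Fin 4) (Matrix (Fin 2) (Fin 2) F)) :
    gamma2 F * blk8 F B * (gamma2 F)⁻¹ = blk8 F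
      !![B 3 3, -B 3 1, -B 3 2, -B 3 0; -B 1 3, B 1 1, B 1 2, B 1 0;
        -B 2 3, B 2 1, B 2 2, B 2 0; -B 0 3, B 0 1, B 0 2, B 0 0] := by
  rw [gamma2_inv, gamma2_eq_blk8, blk8_mul, blk8_mul]
  congr 1
  ext i j : 2
  fin_cases i <;> fin_cases j <;> simp [Matrix.mul_apply, Matrix.vecMul, dotProduct, Fin.sum_univ_four]

theorem SpSet_mul {n : ℕ} {g h : Matrix (Fin (n + n)) (Fin (n + n)) F}
    (hg : g ∈ SpSet F n) (hh : h ∈ SpSet F n) : g * h ∈ SpSet F n := by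
  have hg : gᵀ * OmegaMat F n * g = OmegaMat F n := hg
  have hh : hᵀ * OmegaMat F n * h = OmegaMat F n := hh
  change (g * h)ᵀ * OmegaMat F n * (g * h) = OmegaMat F n
  calc (g * h)ᵀ * OmegaMat F n * (g * h) = hᵀ * (gᵀ * OmegaMat F n * g) * h := by
        simp only [Matrix.transpose_mul, Matrix.mul_assoc]
    _ = OmegaMat F n := by rw [hg, hh]

theorem mem_Sp8_blk8_iff (B : Matrix (Fin 4) (Fin 4) (Matrix (Fin 2) (Fin 2) F)) :
    blk8 F B ∈ Sp8 F ↔ ∀ i j,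
      -(B 3 i)ᵀ * Jmat F 2 * B 0 j - (B 2 i)ᵀ * Jmat F 2 * B 1 j +
        (B 1 i)ᵀ * Jmat F 2 * B 2 j + (B 0 i)ᵀ * Jmat F 2 * B 3 j =
      (!![0, 0, 0, Jmat F 2; 0, 0, Jmat F 2, 0; 0, -Jmat F 2, 0, 0; -Jmat F 2, 0, 0, 0] :
        Matrix (Fin 4) (Fin 4) (Matrix (Fin 2) (Fin 2) F)) i j := by
  change (blk8 F B)ᵀ * OmegaMat F 4 * blk8 F B = OmegaMat F 4 ↔ _
  rw [omegaMat_four, blk8_transpose, blk8_mul, blk8_mul, blk8_inj, ← Matrix.ext_iff]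
  refine forall_congr' fun i => forall_congr' fun j => ?_
  simp [Matrix.mul_apply, Fin.sum_univ_four, sub_eq_add_neg]

theorem mem_Sp4_blk4_iff (B : Matrix (Fin 2) (Fin 2) (Matrix (Fin 2) (Fin 2) F)) :
    blk4 B ∈ Sp4 F ↔ ∀ i j,
      -(B 1 i)ᵀ * Jmat F 2 * B 0 j + (B 0 i)ᵀ * Jmat F 2 * B 1 j =
      (!![0, Jmat F 2; -Jmat F 2, 0] :
        Matrix (Fin 2) (Fin 2) (Matrix (Fin 2) (Fin 2) F)) i j := by
  change (blk4 B)ᵀ * OmegaMat F 2 * blk4 B = OmegaMat F 2 ↔ _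
  rw [omegaMat_two, blk4_transpose, blk4_mul, blk4_mul, blk4_injective.eq_iff, ← Matrix.ext_iff]
  refine forall_congr' fun i => forall_congr' fun j => ?_
  simp [Matrix.mul_apply]

theorem gamma2_mem_Sp8 : gamma2 F ∈ Sp8 F := by
  rw [gamma2_eq_blk8, mem_Sp8_blk8_iff]
  intro i j
  fin_cases i <;> fin_cases j <;> simp

theorem gamma2_inv_mem_Sp8 : (gamma2 F)⁻¹ ∈ Sp8 F := by
  rw [gamma2_inv, mem_Sp8_blk8_iff]
  intro i j
  fin_cases i <;> fin_cases j <;> simp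

theorem blk8_lower_left_eq_zero_iff (B : Matrix (Fin 4) (Fin 4) (Matrix (Fin 2) (Fin 2) F)) :
    (∀ i j : Fin 8, 4 ≤ (i : ℕ) → (j : ℕ) < 4 → blk8 F B i j = 0) ↔
      B 2 0 = 0 ∧ B 2 1 = 0 ∧ B 3 0 = 0 ∧ B 3 1 = 0 := by
  simp [← Matrix.ext_iff, Fin.forall_fin_succ, blk8]
  tauto

theorem mem_P4_blk4_iff (B : Matrix (Fin 2) (Fin 2) (Matrix (Fin 2) (Fin 2) F)) :
    blk4 B ∈ P4 F ↔ blk4 B ∈ Sp4 F ∧ B 1 0 = 0 := by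
  refine and_congr_right fun _ => ?_
  simp [← Matrix.ext_iff, Fin.forall_fin_succ, blk4]

theorem mem_E2_iff (v : Fin 8 → F) : v ∈ E2 F ↔ ∀ i : Fin 8, 2 ≤ (i : ℕ) → v i = 0 := by
  rw [E2, Submodule.mem_span_pair]
  constructor
  · rintro ⟨a, b, rfl⟩ i hi
    have h0 : i ≠ 0 := by rintro rfl; simp at hi
    have h1 : i ≠ 1 := by rintro rfl; simp at hi
    simp [h0, h1]
  · intro h
    refine ⟨v 0, v 1, ?_⟩
    ext i
    by_cases hi : 2 ≤ (i : ℕ)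
    · have h0 : i ≠ 0 := by rintro rfl; simp at hi
      have h1 : i ≠ 1 := by rintro rfl; simp at hi
      simp [h0, h1, h i hi]
    · have : i = 0 ∨ i = 1 := by omega
      rcases this with rfl | rfl <;> simp

theorem blk8_map_E2_le_iff (B : Matrix (Fin 4) (Fin 4) (Matrix (Fin 2) (Fin 2) F)) :
    Submodule.map (blk8 F B).mulVecLin (E2 F) ≤ E2 F ↔ B 1 0 = 0 ∧ B 2 0 = 0 ∧ B 3 0 = 0 := by
  rw [E2, Submodule.map_span_le]
  change (∀ m ∈ _, _ ∈ E2 F) ↔ _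
  simp only [Set.mem_insert_iff, Set.mem_singleton_iff, forall_eq_or_imp, forall_eq, mem_E2_iff]
  simp [← Matrix.ext_iff, Fin.forall_fin_succ, blk8]
  tauto

theorem blk8_map_E2_eq (B : Matrix (Fin 4) (Fin 4) (Matrix (Fin 2) (Fin 2) F))
    (h₀ : IsUnit (B 0 0)) (h₁ : B 1 0 = 0) (h₂ : B 2 0 = 0) (h₃ : B 3 0 = 0) :
    Submodule.map (blk8 F B).mulVecLin (E2 F) = E2 F := by
  refine le_antisymm ((blk8_map_E2_le_iff B).2 ⟨h₁, h₂, h₃⟩) ?_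
  have hinv : B 0 0 * (B 0 0)⁻¹ = 1 :=
    Matrix.mul_nonsing_inv _ ((Matrix.isUnit_iff_isUnit_det _).1 h₀)
  let C : Matrix (Fin 4) (Fin 4) (Matrix (Fin 2) (Fin 2) F) :=
    !![(B 0 0)⁻¹, 0, 0, 0; 0, 0, 0, 0; 0, 0, 0, 0; 0, 0, 0, 0]
  have hC : Submodule.map (blk8 F C).mulVecLin (E2 F) ≤ E2 F :=
    (blk8_map_E2_le_iff C).2 (by simp [C])
  have hBC : blk8 F B * blk8 F C = blk8 F !![1, 0, 0, 0; 0, 0, 0, 0; 0, 0, 0, 0; 0, 0, 0, 0] := by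
    rw [blk8_mul]
    congr 1
    ext i j : 2
    fin_cases i <;> fin_cases j <;>
      simp [C, Matrix.mul_apply, Fin.sum_univ_four, hinv, h₁, h₂, h₃]
  intro v hv
  refine ⟨(blk8 F C).mulVecLin v, hC (Submodule.mem_map_of_mem hv), ?_⟩
  rw [mem_E2_iff] at hv
  simp only [Matrix.mulVecLin_apply, Matrix.mulVec_mulVec, hBC]
  have hentry : ∀ i j, blk8 F !![1, 0, 0, 0; 0, 0, 0, 0; 0, 0, 0, 0; 0, 0, 0, 0] i j =
      if i = j ∧ (i : ℕ) < 2 then 1 else 0 := by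
    intro i j
    fin_cases i <;> fin_cases j <;> rfl
  ext i
  by_cases hi : (i : ℕ) < 2
  · simp [Matrix.mulVec, dotProduct, hentry, hi]
  · simp [Matrix.mulVec, dotProduct, hentry, hi, hv i (by omega)]

theorem Jmat_two_mul_cancel_left (A : Matrix (Fin 2) (Fin 2) F) :
    Jmat F 2 * (Jmat F 2 * A) = A := by
  rw [← Matrix.mul_assoc, Jmat_two_mul_self, Matrix.one_mul]

theorem diag242_mul_vMat (a d y : Matrix (Fin 2) (Fin 2) F)
    (h : Matrix (Fin 2) (Fin 2) (Matrix (Fin 2) (Fin 2) F)) (h₁₀ : h 1 0 = 0) :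
    diag242 F a (blk4 h) d * vMat F 0 y 0 = blk8 F
      !![a, 0, a * y, 0; 0, h 0 0, h 0 1, h 0 0 * starJ F y; 0, 0, h 1 1, 0; 0, 0, 0, d] := by
  rw [diag242_eq_blk8, vMat_eq_blk8, blk8_mul]
  congr 1
  ext i j : 2
  fin_cases i <;> fin_cases j <;> simp [Matrix.mul_apply, Fin.sum_univ_four, h₁₀]

theorem diag242_mul_vMat_mem_Sp8 {a y : Matrix (Fin 2) (Fin 2) F}
    {h : Matrix (Fin 2) (Fin 2) (Matrix (Fin 2) (Fin 2) F)} (ha : IsUnit a)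
    (hh : blk4 h ∈ Sp4 F) (h₁₀ : h 1 0 = 0) :
    diag242 F a (blk4 h) (Jmat F 2 * (a⁻¹)ᵀ * Jmat F 2) * vMat F 0 y 0 ∈ Sp8 F := by
  have hinv : a⁻¹ * a = 1 := Matrix.nonsing_inv_mul _ ((Matrix.isUnit_iff_isUnit_det _).1 ha)
  have hinv' : aᵀ * (a⁻¹)ᵀ = 1 := by rw [← Matrix.transpose_mul, hinv, Matrix.transpose_one]
  have hinvc (A : Matrix (Fin 2) (Fin 2) F) : aᵀ * ((a⁻¹)ᵀ * A) = A := by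
    rw [← Matrix.mul_assoc, hinv', Matrix.one_mul]
  have hinvc' (A : Matrix (Fin 2) (Fin 2) F) : a⁻¹ * (a * A) = A := by
    rw [← Matrix.mul_assoc, hinv, Matrix.one_mul]
  rw [mem_Sp4_blk4_iff] at hh
  have h01 : (h 0 0)ᵀ * (Jmat F 2 * h 1 1) = Jmat F 2 := by
    simpa [h₁₀, Matrix.mul_assoc] using hh 0 1
  have h10 : (h 1 1)ᵀ * (Jmat F 2 * h 0 0) = Jmat F 2 := by
    simpa [h₁₀, Matrix.mul_assoc] using hh 1 0
  have h10c (A : Matrix (Fin 2) (Fin 2) F) :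
      (h 1 1)ᵀ * (Jmat F 2 * (h 0 0 * A)) = Jmat F 2 * A := by
    rw [← Matrix.mul_assoc (Jmat F 2), ← Matrix.mul_assoc, h10]
  have h11 : -((h 1 1)ᵀ * (Jmat F 2 * h 0 1)) + (h 0 1)ᵀ * (Jmat F 2 * h 1 1) = 0 := by
    simpa [Matrix.mul_assoc] using hh 1 1
  rw [diag242_mul_vMat _ _ _ _ h₁₀, mem_Sp8_blk8_iff]
  intro i j
  fin_cases i <;> fin_cases j <;>
    simp [starJ, Matrix.mul_assoc, Jmat_two_transpose, Jmat_two_mul_cancel_left,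
      Jmat_two_mul_self, hinv, hinvc, hinvc', h01, h10, h10c, h11]

theorem exists_diag242_mul_vMat_eq
    {B : Matrix (Fin 4) (Fin 4) (Matrix (Fin 2) (Fin 2) F)} (hB : blk8 F B ∈ Sp8 F)
    (h10 : B 1 0 = 0) (h20 : B 2 0 = 0) (h30 : B 3 0 = 0)
    (h01 : B 0 1 = 0) (h03 : B 0 3 = 0) (h21 : B 2 1 = 0) (h23 : B 2 3 = 0) :
    ∃ (g₀ : Matrix (Fin 2) (Fin 2) F) (h₀ : Matrix (Fin 4) (Fin 4) F)
      (y : Matrix (Fin 2) (Fin 2) F), IsUnit g₀ ∧ h₀ ∈ P4 F ∧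
      blk8 F B = diag242 F g₀ h₀ (Jmat F 2 * (g₀⁻¹)ᵀ * Jmat F 2) * vMat F 0 y 0 := by
  rw [mem_Sp8_blk8_iff] at hB
  have s03 : (B 0 0)ᵀ * (Jmat F 2 * B 3 3) = Jmat F 2 := by
    simpa [h10, h20, h30, Matrix.mul_assoc] using hB 0 3
  have hright : (B 0 0)ᵀ * (Jmat F 2 * B 3 3 * Jmat F 2) = 1 := by
    rw [← Matrix.mul_assoc, s03, Jmat_two_mul_self]
  have hdet : IsUnit (B 0 0).det := by
    rw [← Matrix.det_transpose]
    exact Matrix.isUnit_det_of_right_inverse hright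
  have hunitT : IsUnit (B 0 0)ᵀ.det := by rwa [Matrix.det_transpose]
  have hcancel {A : Matrix (Fin 2) (Fin 2) F} (hA : (B 0 0)ᵀ * (Jmat F 2 * A) = 0) : A = 0 := by
    have h := congrArg (fun M => Jmat F 2 * (((B 0 0)ᵀ)⁻¹ * M)) hA
    simpa [Matrix.nonsing_inv_mul_cancel_left _ _ hunitT, Jmat_two_mul_cancel_left] using h
  have h31 : B 3 1 = 0 := hcancel (by
    simpa [h10, h20, h30, Matrix.mul_assoc] using hB 0 1)
  have h32 : B 3 2 = 0 := hcancel (by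
    simpa [h10, h20, h30, Matrix.mul_assoc] using hB 0 2)
  have h33 : B 3 3 = Jmat F 2 * ((B 0 0)⁻¹)ᵀ * Jmat F 2 := by
    rw [Matrix.transpose_nonsing_inv, Matrix.inv_eq_right_inv hright]
    simp [Matrix.mul_assoc, Jmat_two_mul_cancel_left, Jmat_two_mul_self]
  have s12 : (B 1 1)ᵀ * (Jmat F 2 * B 2 2) = Jmat F 2 := by
    simpa [h01, h21, h31, Matrix.mul_assoc] using hB 1 2
  have s21 : (B 2 2)ᵀ * (Jmat F 2 * B 1 1) = Jmat F 2 := by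
    simpa [h01, h21, h31, h32, Matrix.mul_assoc] using hB 2 1
  have s22 : -((B 2 2)ᵀ * (Jmat F 2 * B 1 2)) + (B 1 2)ᵀ * (Jmat F 2 * B 2 2) = 0 := by
    simpa [h32, Matrix.mul_assoc] using hB 2 2
  have s23 : -((B 2 2)ᵀ * (Jmat F 2 * B 1 3)) + (B 0 2)ᵀ * (Jmat F 2 * B 3 3) = 0 := by
    simpa [h32, h03, h23, Matrix.mul_assoc] using hB 2 3
  have hmid : (B 1 1 * Jmat F 2) * ((B 2 2)ᵀ * Jmat F 2) = 1 := by
    rw [mul_eq_one_comm, Matrix.mul_assoc, ← Matrix.mul_assoc (Jmat F 2),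
      ← Matrix.mul_assoc, s21, Jmat_two_mul_self]
  have h13 : B 1 3 = B 1 1 * starJ F ((B 0 0)⁻¹ * B 0 2) := by
    calc B 1 3 = (B 1 1 * Jmat F 2) * ((B 2 2)ᵀ * Jmat F 2) * B 1 3 := by
          rw [hmid, Matrix.one_mul]
      _ = B 1 1 * (Jmat F 2 * ((B 2 2)ᵀ * (Jmat F 2 * B 1 3))) := by
          simp only [Matrix.mul_assoc]
      _ = B 1 1 * starJ F ((B 0 0)⁻¹ * B 0 2) := by
          rw [neg_add_eq_zero.1 s23, h33]
          simp only [starJ, Matrix.mul_assoc, Jmat_two_mul_cancel_left, Matrix.transpose_mul]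
  refine ⟨B 0 0, blk4 !![B 1 1, B 1 2; 0, B 2 2], (B 0 0)⁻¹ * B 0 2,
    (Matrix.isUnit_iff_isUnit_det _).2 hdet, ?_, ?_⟩
  · refine (mem_P4_blk4_iff _).2 ⟨(mem_Sp4_blk4_iff _).2 fun i j => ?_, rfl⟩
    fin_cases i <;> fin_cases j <;> simp [Matrix.mul_assoc, s12, s21, s22]
  · rw [diag242_mul_vMat _ _ _ _ rfl, ← h33]
    congr 1
    ext i j : 2
    fin_cases i <;> fin_cases j <;>
      simp [h10, h20, h30, h01, h03, h21, h23, h31, h32, ← h13,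
        Matrix.mul_nonsing_inv_cancel_left _ _ hdet]

end BlockMatrices

/-- the stabilizer `{ p ∈ P_{2,8}(F) : γ₂ p γ₂⁻¹ ∈ P_8(F) }` consists of
the products `diag(g₀, h₀, J₂ ᵗg₀⁻¹ J₂) · v(0,y,0)` with `g₀ ∈ GL_2(F)`,
`h₀ ∈ P_4(F)`, `y ∈ Mat_2(F)`. -/
theorem statement16 (F : Type*) [Field F] :
    {p | p ∈ P28 F ∧ gamma2 F * p * (gamma2 F)⁻¹ ∈ P8 F} =
      {g | ∃ (g₀ : Matrix (Fin 2) (Fin 2) F) (h₀ : Matrix (Fin 4) (Fin 4) F)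
            (y : Matrix (Fin 2) (Fin 2) F),
          IsUnit g₀ ∧ h₀ ∈ P4 F ∧
          g = diag242 F g₀ h₀ (Jmat F 2 * (g₀⁻¹)ᵀ * Jmat F 2) * vMat F 0 y 0} := by
  ext p
  simp only [Set.mem_ofPred_eq]
  constructor
  · rintro ⟨⟨hp, hE⟩, -, hγ⟩
    obtain ⟨B, rfl⟩ := exists_blk8 p
    obtain ⟨h10, h20, h30⟩ := (blk8_map_E2_le_iff B).1 hE.le
    rw [conj_gamma2, blk8_lower_left_eq_zero_iff] at hγ
    obtain ⟨h23, h21, h03, h01⟩ := hγ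
    exact exists_diag242_mul_vMat_eq hp h10 h20 h30 h01 (neg_eq_zero.1 h03) h21
      (neg_eq_zero.1 h23)
  · rintro ⟨a, h, y, ha, hh, rfl⟩
    obtain ⟨h, rfl⟩ := exists_blk4 h
    obtain ⟨hSp, h10⟩ := (mem_P4_blk4_iff h).1 hh
    have hmem := diag242_mul_vMat_mem_Sp8 (y := y) ha hSp h10
    refine ⟨⟨hmem, ?_⟩, SpSet_mul (SpSet_mul gamma2_mem_Sp8 hmem) gamma2_inv_mem_Sp8, ?_⟩
    · rw [diag242_mul_vMat _ _ _ _ h10]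
      exact blk8_map_E2_eq _ ha rfl rfl rfl
    · rw [diag242_mul_vMat _ _ _ _ h10, conj_gamma2, blk8_lower_left_eq_zero_iff]
      simp

end

end GS
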